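/- For every complex q with |q| < 1 and every positive integer n, the coefficient of qⁿ in θ₃(q)² = (∑_{m ∈ ℤ} q^{m²})² equals 4·(#{d : d | n, d ≡ 1 (mod 4)} - #{d : d | n, d ≡ 3 (mod 4)}); equivalently θ₃(q)² = 1 + 4 ∑_{n=1}^∞ (qⁿ/(1-q^{4n}) applied to character) = 1 + 4 ∑_{n=1}^∞ χ₄(n) qⁿ/(1-qⁿ) where χ₄ is the nontrivial character mod 4. -/

import Mathlib

/-- `θ₃(q) = ∑_{m ∈ ℤ} q^{m²}`. -/
noncomputable def theta3 (q : ℂ) : ℂ := ∑' m : ℤ, q ^ (m ^ 2)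

/-- The nontrivial character mod 4: `χ₄(n) = 1` if `n ≡ 1 (4)`, `-1` if `n ≡ 3 (4)`, `0` else. -/
def chi4 (n : ℕ) : ℤ := if n % 4 = 1 then 1 else if n % 4 = 3 then -1 else 0

/-- divisor sum of the character -/
def dsum (n : ℕ) : ℤ := ∑ d ∈ n.divisors, chi4 d

/-- value at `m / p`, zero if `p ∤ m` -/
def atQuot (f : ℕ → ℤ) (p m : ℕ) : ℤ := if p ∣ m then f (m / p) else 0

lemma chi4_mul (a b : ℕ) : chi4 (a * b) = chi4 a * chi4 b := by
  unfold chi4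
  rw [Nat.mul_mod]
  have ha : a % 4 < 4 := Nat.mod_lt _ (by norm_num)
  have hb : b % 4 < 4 := Nat.mod_lt _ (by norm_num)
  generalize a % 4 = x at *
  generalize b % 4 = y at *
  interval_cases x <;> interval_cases y <;> rfl

lemma dsum_rec (p m : ℕ) (hp : p.Prime) (hm : 0 < m) :
    dsum (p * m) = (1 + chi4 p) * dsum m - chi4 p * atQuot dsum p m := by
  have hinj : Function.Injective (fun e : ℕ => p * e) := fun a b h =>
    Nat.eq_of_mul_eq_mul_left hp.pos h
  have hU : (p * m).divisors = m.divisors ∪ m.divisors.image (fun e => p * e) := by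
    ext d
    simp only [Nat.mem_divisors, Finset.mem_union, Finset.mem_image]
    constructor
    · rintro ⟨hd, _⟩
      by_cases hpd : p ∣ d
      · obtain ⟨e, rfl⟩ := hpd
        right
        exact ⟨e, ⟨Nat.dvd_of_mul_dvd_mul_left hp.pos hd, hm.ne'⟩, rfl⟩
      · left
        exact ⟨(Nat.Coprime.symm ((Nat.Prime.coprime_iff_not_dvd hp).2 hpd)).dvd_of_dvd_mul_left hd,
          hm.ne'⟩
    · have h0 : p * m ≠ 0 := (Nat.mul_pos hp.pos hm).ne'
      rintro (⟨h, _⟩ | ⟨e, ⟨h, _⟩, rfl⟩)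
      · exact ⟨h.mul_left _, h0⟩
      · exact ⟨Nat.mul_dvd_mul_left _ h, h0⟩
  have hI : ∑ d ∈ m.divisors ∩ m.divisors.image (fun e => p * e), chi4 d
      = chi4 p * atQuot dsum p m := by
    unfold atQuot
    split_ifs with hpm
    · obtain ⟨k, rfl⟩ := hpm
      have hk : 0 < k := Nat.pos_of_mul_pos_left hm
      have : (p * k).divisors ∩ (p * k).divisors.image (fun e => p * e)
          = k.divisors.image (fun e => p * e) := by
        ext d
        simp only [Nat.mem_divisors, Finset.mem_inter, Finset.mem_image]
        constructor
        · rintro ⟨⟨h1, _⟩, ⟨e, ⟨h, _⟩, rfl⟩⟩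
          exact ⟨e, ⟨Nat.dvd_of_mul_dvd_mul_left hp.pos h1, hk.ne'⟩, rfl⟩
        · rintro ⟨e, ⟨h, _⟩, rfl⟩
          exact ⟨⟨Nat.mul_dvd_mul_left _ h, hm.ne'⟩, ⟨e, ⟨h.mul_left _, hm.ne'⟩, rfl⟩⟩
      rw [this, Finset.sum_image (fun a _ b _ h => hinj h), Nat.mul_div_cancel_left _ hp.pos, dsum,
        Finset.mul_sum]
      exact Finset.sum_congr rfl fun e _ => chi4_mul _ _
    · have : m.divisors ∩ m.divisors.image (fun e => p * e) = ∅ := by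
        ext d
        simp only [Nat.mem_divisors, Finset.mem_inter, Finset.mem_image, Finset.notMem_empty,
          iff_false]
        rintro ⟨⟨h1, _⟩, ⟨e, ⟨h, _⟩, rfl⟩⟩
        exact hpm ((Dvd.intro _ rfl).trans h1)
      rw [this]; simp
  have h := Finset.sum_union_inter (s₁ := m.divisors) (s₂ := m.divisors.image (fun e => p * e))
    (f := chi4)
  rw [← hU, hI, Finset.sum_image (fun a _ b _ h => hinj h)] at h
  simp only [chi4_mul, ← Finset.mul_sum] at h
  change dsum (p * m) + _ = dsum m + _ * dsum m at h
  linarith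

/-- Gaussian integers of norm `n` -/
def normSet (n : ℕ) : Set GaussianInt := {z | z.norm = n}

lemma norm_eq_sq (z : GaussianInt) : z.norm = z.re ^ 2 + z.im ^ 2 := by
  rw [Zsqrtd.norm_def]; ring

lemma normSet_finite (n : ℕ) : (normSet n).Finite := by
  refine Set.Finite.subset (((Finset.Icc (-(n : ℤ)) n) ×ˢ (Finset.Icc (-(n : ℤ)) n)).image
    (fun x : ℤ × ℤ => (⟨x.1, x.2⟩ : GaussianInt))).finite_toSet ?_
  intro z hz
  have hz' : z.re ^ 2 + z.im ^ 2 = n := by rw [← norm_eq_sq]; exact hz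
  simp only [Finset.coe_image, Set.mem_image, Finset.mem_coe, Finset.mem_product, Finset.mem_Icc]
  refine ⟨(z.re, z.im), ⟨⟨?_, ?_⟩, ⟨?_, ?_⟩⟩, rfl⟩ <;> dsimp only <;>
    nlinarith [sq_nonneg z.re, sq_nonneg z.im, Int.le_self_sq z.re, Int.le_self_sq z.im,
      Int.le_self_sq (-z.re), Int.le_self_sq (-z.im)]

/-- the number of Gaussian integers of norm `n` -/
noncomputable def cnt (n : ℕ) : ℤ := (normSet n).ncard

lemma ncard_mul (a : GaussianInt) (ha : a ≠ 0) (S : Set GaussianInt) :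
    ((fun w => a * w) '' S).ncard = S.ncard :=
  Set.ncard_image_of_injective _ (mul_right_injective₀ ha)

lemma atQuot_cnt (p m : ℕ) (hp : p.Prime) :
    atQuot cnt p m = (({w : GaussianInt | (p : ℤ) * w.norm = m}.ncard : ℕ) : ℤ) := by
  unfold atQuot
  have hp0 : (p : ℤ) ≠ 0 := by exact_mod_cast hp.ne_zero
  split_ifs with h
  · obtain ⟨k, rfl⟩ := h
    rw [Nat.mul_div_cancel_left _ hp.pos, cnt, normSet]
    congr 2
    ext w
    simp only [Set.mem_ofPred_eq]
    push_cast
    exact (mul_right_inj' hp0).symm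
  · have : {w : GaussianInt | (p : ℤ) * w.norm = m} = ∅ := by
      ext w
      simp only [Set.mem_ofPred_eq, Set.mem_empty_iff_false, iff_false]
      intro hw
      exact h (by exact_mod_cast (Dvd.intro _ hw : (p : ℤ) ∣ m))
    rw [this]; simp

lemma prime_of_norm (z : GaussianInt) (p : ℕ) (hp : p.Prime) (hz : z.norm = p) : Prime z := by
  rw [← irreducible_iff_prime]
  refine ⟨fun hu => ?_, fun a b hab => ?_⟩
  · rw [Zsqrtd.isUnit_iff_norm_isUnit, hz] at hu
    rw [Int.isUnit_iff] at hu
    have := hp.two_le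
    omega
  · have h : a.norm.natAbs * b.norm.natAbs = p := by
      rw [← Int.natAbs_mul, ← Zsqrtd.norm_mul, ← hab, hz, Int.natAbs_natCast]
    rcases (Nat.prime_mul_iff.1 (h ▸ hp)) with ⟨_, h2⟩ | ⟨_, h2⟩
    · right; exact Zsqrtd.norm_eq_one_iff.1 h2
    · left; exact Zsqrtd.norm_eq_one_iff.1 h2

lemma star_dvd_star' (a b : GaussianInt) (h : a ∣ b) : star a ∣ star b := by
  obtain ⟨c, rfl⟩ := h
  exact ⟨star c, by rw [star_mul, mul_comm]⟩

lemma dvd_or (π z : GaussianInt) (hπ : Prime π) (h : π ∣ (z.norm : GaussianInt)) :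
    π ∣ z ∨ star π ∣ z := by
  rw [Zsqrtd.norm_eq_mul_conj] at h
  rcases hπ.dvd_or_dvd h with h | h
  · exact Or.inl h
  · right; simpa using star_dvd_star' _ _ h

lemma cnt_rec (p m : ℕ) (hp : p.Prime) :
    cnt (p * m) = (1 + chi4 p) * cnt m - chi4 p * atQuot cnt p m := by
  haveI := Fact.mk hp
  have hp0 : (p : ℤ) ≠ 0 := by exact_mod_cast hp.ne_zero
  have hpg : (p : GaussianInt) ≠ 0 := by exact_mod_cast hp.ne_zero
  have hnp : (p : GaussianInt).norm = p * p := by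
    simpa using Zsqrtd.norm_natCast (d := -1) p
  by_cases h3 : p % 4 = 3
  · have hpr := GaussianInt.prime_of_nat_prime_of_mod_four_eq_three p h3
    have hS : normSet (p * m) = (fun w => (p : GaussianInt) * w) ''
        {w : GaussianInt | (p : ℤ) * w.norm = m} := by
      ext z
      simp only [normSet, Set.mem_ofPred_eq, Set.mem_image]
      constructor
      · intro hz
        have hd : (p : GaussianInt) ∣ z := by
          rcases dvd_or _ z hpr ⟨m, by rw [hz]; push_cast; rfl⟩ with h | h
          · exact h
          · simpa using h
        obtain ⟨w, rfl⟩ := hd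
        refine ⟨w, ?_, rfl⟩
        rw [Zsqrtd.norm_mul, hnp, mul_assoc] at hz
        push_cast at hz
        exact mul_left_cancel₀ hp0 hz
      · rintro ⟨w, hw, rfl⟩
        rw [Zsqrtd.norm_mul, hnp, mul_assoc, hw]
        push_cast; rfl
    have hc : chi4 p = -1 := by simp [chi4, h3]
    rw [hc, cnt, hS, ncard_mul _ hpg, atQuot_cnt p m hp]
    ring
  · obtain ⟨a, b, hab⟩ := Nat.Prime.sq_add_sq (p := p) h3
    have hab' : (a : ℤ) ^ 2 + (b : ℤ) ^ 2 = p := by exact_mod_cast hab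
    set π : GaussianInt := ⟨a, b⟩ with hπd
    have hn : π.norm = p := by rw [norm_eq_sq]; exact hab'
    have hns : (star π).norm = p := by rw [Zsqrtd.norm_conj, hn]
    have hπ := prime_of_norm π p hp hn
    have hπs := prime_of_norm (star π) p hp hns
    have hpp : (p : GaussianInt) = π * star π := by
      rw [← Zsqrtd.norm_eq_mul_conj, hn]; push_cast; rfl
    have hmem : ∀ ρ : GaussianInt, ρ.norm = p → ∀ z, z ∈ (fun w => ρ * w) '' normSet m ↔
        z ∈ normSet (p * m) ∧ ρ ∣ z := by
      intro ρ hρ z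
      simp only [normSet, Set.mem_ofPred_eq, Set.mem_image]
      constructor
      · rintro ⟨w, hw, rfl⟩
        exact ⟨by rw [Zsqrtd.norm_mul, hρ, hw]; push_cast; rfl, Dvd.intro _ rfl⟩
      · rintro ⟨hz, w, rfl⟩
        refine ⟨w, ?_, rfl⟩
        rw [Zsqrtd.norm_mul, hρ] at hz
        push_cast at hz
        exact mul_left_cancel₀ hp0 hz
    have hor : ∀ z ∈ normSet (p * m), π ∣ z ∨ star π ∣ z := by
      intro z hz
      refine dvd_or _ z hπ ?_
      have hz : z.norm = (p * m : ℕ) := hz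
      rw [hz]
      push_cast
      rw [hpp, mul_assoc]
      exact Dvd.intro _ rfl
    by_cases h2 : p = 2
    · have hss : star π ∣ π := by
        subst h2
        have ha : a = 1 := by
          have : a < 2 := by nlinarith
          have : b < 2 := by nlinarith
          interval_cases a <;> interval_cases b <;> simp_all
        have hb : b = 1 := by
          subst ha
          have : b < 2 := by nlinarith
          interval_cases b <;> simp_all
        refine ⟨⟨0, 1⟩, ?_⟩
        rw [hπd]
        subst ha hb
        ext <;> simp
      have hss' : π ∣ star π := by simpa using star_dvd_star' _ _ hss
      have hS : normSet (p * m) = (fun w => π * w) '' normSet m := by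
        ext z
        rw [hmem π hn z]
        constructor
        · intro hz
          refine ⟨hz, ?_⟩
          rcases hor z hz with h | h
          · exact h
          · exact hss'.trans h
        · exact fun h => h.1
      have hc : chi4 p = 0 := by subst h2; rfl
      rw [hc, cnt, hS, ncard_mul _ hπ.ne_zero, cnt]
      ring
    · have hc : chi4 p = 1 := by
        have : p % 2 = 1 := hp.eq_two_or_odd.resolve_left h2
        have : p % 4 = 1 := by omega
        simp [chi4, this]
      have hns' : ¬ star π ∣ π := by
        intro h
        have h' : star π ∣ ((2 * a : ℤ) : GaussianInt) := by
          have : ((2 * a : ℤ) : GaussianInt) = π + star π := by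
            rw [hπd]; ext <;> simp; ring
          rw [this]
          exact dvd_add h dvd_rfl
        obtain ⟨c, hcc⟩ := h'
        have h4 := congrArg Zsqrtd.norm hcc
        rw [Zsqrtd.norm_mul, hns, Zsqrtd.norm_intCast] at h4
        have h5 : p ∣ (2 * a) * (2 * a) := by
          have : (p : ℤ) ∣ (2 * a) * (2 * a) := ⟨_, h4⟩
          exact_mod_cast this
        have h6 : p ∣ 2 * a := by
          rcases (Nat.Prime.dvd_mul hp).1 h5 with h | h <;> exact h
        have h7 : p ∣ a := by
          rcases (Nat.Prime.dvd_mul hp).1 h6 with h | h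
          · exact absurd ((Nat.prime_dvd_prime_iff_eq hp Nat.prime_two).1 h) h2
          · exact h
        have h8 : p ∣ b := by
          have : p ∣ b ^ 2 := by
            rw [← Nat.dvd_add_right (h7.trans (Dvd.intro_left (a ^ 1) (by ring) : a ∣ a ^ 2)), hab]
          exact hp.dvd_of_dvd_pow this
        obtain ⟨x, rfl⟩ := h7
        obtain ⟨y, rfl⟩ := h8
        have h9 : p * (x ^ 2 + y ^ 2) = 1 := by
          have : p * (p * (x ^ 2 + y ^ 2)) = p * 1 := by rw [mul_one]; nlinarith
          exact Nat.eq_of_mul_eq_mul_left hp.pos this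
        exact hp.one_lt.ne' (Nat.eq_one_of_mul_eq_one_right h9)
      have hS : normSet (p * m) = (fun w => π * w) '' normSet m ∪
          (fun w => star π * w) '' normSet m := by
        ext z
        rw [Set.mem_union, hmem π hn z, hmem _ hns z]
        have := hor z
        tauto
      have hI : (fun w => π * w) '' normSet m ∩ (fun w => star π * w) '' normSet m =
          (fun w => (p : GaussianInt) * w) '' {w : GaussianInt | (p : ℤ) * w.norm = m} := by
        ext z
        rw [Set.mem_inter_iff, hmem π hn z, hmem _ hns z]
        simp only [normSet, Set.mem_ofPred_eq, Set.mem_image]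
        constructor
        · rintro ⟨⟨hz, w, rfl⟩, _, h⟩
          rcases hπs.dvd_or_dvd h with h | h
          · exact absurd h hns'
          · obtain ⟨v, rfl⟩ := h
            refine ⟨v, ?_, by rw [hpp]; ring⟩
            rw [Zsqrtd.norm_mul, Zsqrtd.norm_mul, hn, hns] at hz
            push_cast at hz
            exact mul_left_cancel₀ hp0 hz
        · rintro ⟨w, hw, rfl⟩
          have : ((p : GaussianInt) * w).norm = (p * m : ℕ) := by
            rw [Zsqrtd.norm_mul, hnp, mul_assoc, hw]; push_cast; rfl
          refine ⟨⟨this, ?_⟩, this, ?_⟩ <;> rw [hpp]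
          · exact ⟨star π * w, by ring⟩
          · exact ⟨π * w, by ring⟩
      have h := Set.ncard_union_add_ncard_inter ((fun w => π * w) '' normSet m)
        ((fun w => star π * w) '' normSet m) ((normSet_finite m).image _)
        ((normSet_finite m).image _)
      rw [← hS, hI, ncard_mul _ hpg, ncard_mul _ hπ.ne_zero, ncard_mul _ hπs.ne_zero] at h
      have h' : cnt (p * m) + atQuot cnt p m = cnt m + cnt m := by
        rw [atQuot_cnt p m hp]
        simp only [cnt]
        exact_mod_cast h
      rw [hc]; linarith

lemma cnt_one : cnt 1 = 4 := by
  have : normSet 1 = ((({⟨1, 0⟩, ⟨-1, 0⟩, ⟨0, 1⟩, ⟨0, -1⟩} : Finset GaussianInt)) :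
      Set GaussianInt) := by
    ext z
    simp only [normSet, Set.mem_ofPred_eq, norm_eq_sq, Finset.coe_insert, Finset.coe_singleton,
      Set.mem_insert_iff, Set.mem_singleton_iff, Zsqrtd.ext_iff]
    constructor
    · intro h
      push_cast at h
      have h1 : z.re ≤ 1 := by nlinarith
      have h2 : -1 ≤ z.re := by nlinarith
      have h3 : z.im ≤ 1 := by nlinarith
      have h4 : -1 ≤ z.im := by nlinarith
      generalize z.re = x at *
      generalize z.im = y at *
      interval_cases x <;> interval_cases y <;> simp_all
    · rintro (⟨h, h'⟩ | ⟨h, h'⟩ | ⟨h, h'⟩ | ⟨h, h'⟩) <;> rw [h, h'] <;> norm_num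
  rw [cnt, this, Set.ncard_coe_finset]
  rfl

theorem cnt_eq (n : ℕ) (hn : 0 < n) : cnt n = 4 * dsum n := by
  induction n using Nat.strong_induction_on with
  | _ n ih =>
    by_cases h1 : n = 1
    · subst h1; rw [cnt_one]; rfl
    · obtain ⟨p, hp, m, rfl⟩ := Nat.exists_prime_and_dvd h1
      have hm : 0 < m := Nat.pos_of_mul_pos_left hn
      have hlt : m < p * m := by nlinarith [hp.two_le]
      rw [cnt_rec p m hp, dsum_rec p m hp hm, ih m hlt hm]
      have : atQuot cnt p m = 4 * atQuot dsum p m := by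
        unfold atQuot
        split_ifs with h
        · obtain ⟨k, rfl⟩ := h
          have hk : 0 < k := Nat.pos_of_mul_pos_left hm
          rw [Nat.mul_div_cancel_left _ hp.pos]
          exact ih k (by nlinarith [hp.two_le]) hk
        · rfl
      rw [this]; ring

lemma dsum_eq (n : ℕ) : dsum n = ((n.divisors.filter fun d => d % 4 = 1).card : ℤ)
            - ((n.divisors.filter fun d => d % 4 = 3).card : ℤ) := by
  rw [dsum, Finset.card_filter, Finset.card_filter]
  push_cast
  rw [← Finset.sum_sub_distrib]
  refine Finset.sum_congr rfl fun d _ => ?_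
  unfold chi4
  split_ifs <;> first | omega | rfl

lemma card_eq_cnt (n : ℕ) : (Nat.card {p : ℤ × ℤ // p.1 ^ 2 + p.2 ^ 2 = n} : ℤ) = cnt n := by
  rw [cnt, ← Nat.card_coe_set_eq]
  congr 1
  refine Nat.card_congr ⟨fun x => ⟨⟨x.1.1, x.1.2⟩, ?_⟩, fun z => ⟨(z.1.re, z.1.im), ?_⟩,
    fun _ => rfl, fun _ => rfl⟩
  · exact (norm_eq_sq _).trans x.2
  · exact (norm_eq_sq _).symm.trans z.2

lemma summable_theta (q : ℂ) (hq : ‖q‖ < 1) : Summable fun m : ℤ => ‖q ^ (m ^ 2)‖ := by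
  have hg := summable_geometric_of_lt_one (norm_nonneg q) hq
  have key : ∀ m : ℤ, ‖q ^ (m ^ 2)‖ ≤ ‖q‖ ^ m.natAbs := by
    intro m
    have : m ^ 2 = ((m.natAbs ^ 2 : ℕ) : ℤ) := by push_cast; rw [sq_abs]
    rw [this, zpow_natCast, norm_pow]
    exact pow_le_pow_of_le_one (norm_nonneg q) hq.le (Nat.le_self_pow (by norm_num) _)
  refine Summable.of_nonneg_of_le (fun _ => norm_nonneg _) key ?_
  refine Summable.of_nat_of_neg ?_ ?_ <;> simpa using hg

lemma theta_sq (q : ℂ) (hq : ‖q‖ < 1) :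
    Summable (fun n : ℕ => (cnt n : ℂ) * q ^ n) ∧
    theta3 q ^ 2 = ∑' n : ℕ, (cnt n : ℂ) * q ^ n := by
  have hs := summable_theta q hq
  have hm := tsum_mul_tsum_of_summable_norm hs hs
  have hsum : Summable fun x : ℤ × ℤ => q ^ (x.1 ^ 2) * q ^ (x.2 ^ 2) :=
    summable_mul_of_summable_norm (f := fun m : ℤ => q ^ (m ^ 2))
      (g := fun m : ℤ => q ^ (m ^ 2)) hs hs
  obtain ⟨f, hfd⟩ : ∃ f : ℤ × ℤ → ℕ, ∀ x, f x = x.1.natAbs ^ 2 + x.2.natAbs ^ 2 :=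
    ⟨fun x => x.1.natAbs ^ 2 + x.2.natAbs ^ 2, fun x => rfl⟩
  have hf : ∀ x : ℤ × ℤ, ((f x : ℕ) : ℤ) = x.1 ^ 2 + x.2 ^ 2 := by
    intro x; rw [hfd]; simp
  have hterm : ∀ x : ℤ × ℤ, q ^ (x.1 ^ 2) * q ^ (x.2 ^ 2) = q ^ f x := by
    intro x
    have : ∀ m : ℤ, m ^ 2 = ((m.natAbs ^ 2 : ℕ) : ℤ) := by intro m; push_cast; rw [sq_abs]
    rw [this x.1, this x.2, zpow_natCast, zpow_natCast, ← pow_add, hfd]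
  simp_rw [hterm] at hsum hm
  have hfib : ∀ n : ℕ, ∑' z : {x // f x = n}, q ^ f z.1 = (cnt n : ℂ) * q ^ n := by
    intro n
    have : ∀ z : {x // f x = n}, q ^ f z.1 = q ^ n := fun z => by rw [z.2]
    have hc : Nat.card {x // f x = n} = Nat.card {p : ℤ × ℤ // p.1 ^ 2 + p.2 ^ 2 = n} := by
      refine Nat.card_congr (Equiv.subtypeEquivRight fun x => ?_)
      rw [← hf x]; exact Nat.cast_inj.symm
    rw [tsum_congr this, tsum_const, nsmul_eq_mul, ← card_eq_cnt, Int.cast_natCast, hc]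
  have hsum' : Summable (fun s : (n : ℕ) × {x // f x = n} => q ^ f s.2.1) :=
    (Equiv.sigmaFiberEquiv f).summable_iff.2 hsum
  have heq : ∑' s : (n : ℕ) × {x // f x = n}, q ^ f s.2.1 = ∑' x, q ^ f x :=
    (Equiv.sigmaFiberEquiv f).tsum_eq (fun x => q ^ f x)
  constructor
  · have := hsum'.sigma
    refine this.congr fun n => ?_
    exact hfib n
  · rw [sq, theta3, hm, ← heq, Summable.tsum_sigma hsum']
    exact tsum_congr hfib

lemma lambert (q : ℂ) (hq : ‖q‖ < 1) :
    ∑' m : ℕ, (chi4 (m + 1) : ℂ) * q ^ (m + 1) / (1 - q ^ (m + 1)) =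
      ∑' n : ℕ, (dsum (n + 1) : ℂ) * q ^ (n + 1) := by
  have hchi : ∀ n, ‖(chi4 n : ℂ)‖ ≤ 1 := by
    intro n; unfold chi4; split_ifs <;> simp
  have hS : Summable fun c : ℕ+ × ℕ+ => (chi4 c.1 : ℂ) * q ^ (c.1 * c.2 : ℕ) := by
    have h := (summable_prod_mul_pow 0 hq).norm
    refine Summable.of_norm_bounded h fun c => ?_
    rw [norm_mul, norm_mul]
    simpa using mul_le_mul_of_nonneg_right (hchi c.1) (norm_nonneg (q ^ (c.1 * c.2 : ℕ)))
  rw [← tsum_pnat_eq_tsum_succ (f := fun m => (chi4 m : ℂ) * q ^ m / (1 - q ^ m)),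
    ← tsum_pnat_eq_tsum_succ (f := fun m => (dsum m : ℂ) * q ^ m)]
  have h1 : ∑' c : ℕ+ × ℕ+, (chi4 c.1 : ℂ) * q ^ (c.1 * c.2 : ℕ) =
      ∑' m : ℕ+, (chi4 m : ℂ) * q ^ (m : ℕ) / (1 - q ^ (m : ℕ)) := by
    rw [hS.tsum_prod]
    refine tsum_congr fun m => ?_
    have hlt : ‖q ^ (m : ℕ)‖ < 1 := by
      rw [norm_pow]; exact pow_lt_one₀ (norm_nonneg _) hq m.ne_zero
    dsimp only
    rw [tsum_mul_left, tsum_pnat_eq_tsum_succ (f := fun c => q ^ ((m : ℕ) * c))]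
    simp_rw [pow_mul, pow_succ']
    rw [tsum_mul_left, tsum_geometric_of_norm_lt_one hlt]
    ring
  rw [← h1, ← sigmaAntidiagonalEquivProd.tsum_eq]
  have hS' := sigmaAntidiagonalEquivProd.summable_iff.2 hS
  refine (Summable.tsum_sigma hS').trans (tsum_congr fun n => ?_)
  simp only [Function.comp_apply]
  rw [tsum_fintype]
  have : ∀ b : {x // x ∈ Nat.divisorsAntidiagonal n},
      (chi4 (sigmaAntidiagonalEquivProd ⟨n, b⟩).1 : ℂ) *
        q ^ ((sigmaAntidiagonalEquivProd ⟨n, b⟩).1 * (sigmaAntidiagonalEquivProd ⟨n, b⟩).2 : ℕ) =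
      (chi4 b.1.1 : ℂ) * q ^ (n : ℕ) := by
    intro b
    have hb := divisorsAntidiagonalFactors_eq b
    change (chi4 (divisorsAntidiagonalFactors n b).1 : ℂ) * q ^ ((divisorsAntidiagonalFactors n b).1.1 * (divisorsAntidiagonalFactors n b).2.1) = _
    rw [hb]; rfl
  rw [Finset.sum_congr rfl fun b _ => this b, ← Finset.sum_mul]
  congr 1
  rw [Finset.univ_eq_attach, Finset.sum_attach (Nat.divisorsAntidiagonal n)
    (fun x => (chi4 x.1 : ℂ)), Nat.sum_divisorsAntidiagonal (fun x _ => (chi4 x : ℂ)), dsum]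
  push_cast
  rfl

/-- Two-squares theorem in Lambert series form: the number of representations of `n ≥ 1`
as `x²+y²` is `4(#{d∣n, d≡1 (4)} - #{d∣n, d≡3 (4)})`, and
`θ₃(q)² = 1 + 4 ∑_{n≥1} χ₄(n) qⁿ/(1-qⁿ)` for `|q| < 1`. -/
theorem stmt_13 (q : ℂ) (hq : ‖q‖ < 1) (n : ℕ) (hn : 0 < n) :
    (Nat.card {p : ℤ × ℤ // p.1 ^ 2 + p.2 ^ 2 = n} : ℤ) =
      4 * (((n.divisors.filter fun d => d % 4 = 1).card : ℤ)
            - ((n.divisors.filter fun d => d % 4 = 3).card : ℤ)) ∧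
    theta3 q ^ 2 =
      1 + 4 * ∑' m : ℕ, (chi4 (m + 1) : ℂ) * q ^ (m + 1) / (1 - q ^ (m + 1)) := by

  refine ⟨by rw [card_eq_cnt, cnt_eq n hn, dsum_eq], ?_⟩
  obtain ⟨hs, h⟩ := theta_sq q hq
  have h0 : cnt 0 = 1 := by
    have : normSet 0 = {0} := by
      ext z
      simp only [normSet, Set.mem_ofPred_eq, Set.mem_singleton_iff, Nat.cast_zero]
      exact GaussianInt.norm_eq_zero
    rw [cnt, this]; simp
  rw [h, hs.tsum_eq_zero_add, lambert q hq, h0, ← tsum_mul_left]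
  simp only [Int.cast_one, pow_zero, mul_one]
  congr 1
  refine tsum_congr fun k => ?_
  rw [cnt_eq (k + 1) k.succ_pos]
  push_cast
  ring
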